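/- Let (H, μ, Δ, α_H) be a Hom-bialgebra with α_H bijective, and let (M, α_M), (N, α_N), (P, α_P), (Q, α_Q) be Yetter-Drinfeld modules over H with bijective structure maps. Then the associators 𝔞_{X,Y,Z}((x⊗y)⊗z) = α_X(x)⊗(y⊗α_Z^{-1}(z)) satisfy the pentagon axiom (id_M⊗𝔞_{N,P,Q}) ∘ 𝔞_{M,N⊗̃P,Q} ∘ (𝔞_{M,N,P}⊗id_Q) = 𝔞_{M,N,P⊗̃Q} ∘ 𝔞_{M⊗̃N,P,Q}, and with the quasi-braidings c_{X,Y}(x⊗y) = α_Y^{-1}(α_H^{-1}(x_{(-1)})·y)⊗α_X^{-1}(x_{(0)}) (where for c_{M,N⊗̃P} the coaction of M and the ⊗̃ action on N⊗̃P are used, and similarly for c_{M⊗̃N,P}) the two hexagon relations hold: 𝔞_{N,P,M} ∘ c_{M,N⊗̃P} ∘ 𝔞_{M,N,P} = (id_N⊗c_{M,P}) ∘ 𝔞_{N,M,P} ∘ (c_{M,N}⊗id_P), and 𝔞_{P,M,N}^{-1} ∘ c_{M⊗̃N,P} ∘ 𝔞_{M,N,P}^{-1} = (c_{M,P}⊗id_N)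 ∘ 𝔞_{M,P,N}^{-1} ∘ (id_M⊗c_{N,P}). -/

import Mathlib

open TensorProduct

noncomputable section

namespace HomYD

variable (k : Type*) [Field k]
variable {H M N : Type*}
variable [AddCommGroup H] [Module k H]
variable [AddCommGroup M] [Module k M]
variable [AddCommGroup N] [Module k N]

/-- Rearrangement `(a ⊗ b) ⊗ c ↦ (a ⊗ c) ⊗ b`. -/
def rearr (A B C : Type*) [AddCommGroup A] [Module k A] [AddCommGroup B] [Module k B]
    [AddCommGroup C] [Module k C] :
    (A ⊗[k] B) ⊗[k] C →ₗ[k] (A ⊗[k] C) ⊗[k] B :=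
  (TensorProduct.assoc k A C B).symm.toLinearMap ∘ₗ
    (TensorProduct.map LinearMap.id (TensorProduct.comm k B C).toLinearMap) ∘ₗ
      (TensorProduct.assoc k A B C).toLinearMap

/-- Middle-four exchange `(a ⊗ b) ⊗ (c ⊗ d) ↦ (a ⊗ c) ⊗ (b ⊗ d)`. -/
def ttc (A B C D : Type*) [AddCommGroup A] [Module k A] [AddCommGroup B] [Module k B]
    [AddCommGroup C] [Module k C] [AddCommGroup D] [Module k D] :
    (A ⊗[k] B) ⊗[k] (C ⊗[k] D) →ₗ[k] (A ⊗[k] C) ⊗[k] (B ⊗[k] D) :=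
  (TensorProduct.tensorTensorTensorComm k A B C D).toLinearMap

/-- Hom-bialgebra (no unit/counit): multiplicativity of `α`, Hom-associativity,
comultiplicativity of `α`, Hom-coassociativity, and `Δ` multiplicative. -/
structure IsHomBialgebra (μ : H ⊗[k] H →ₗ[k] H) (Δ : H →ₗ[k] H ⊗[k] H)
    (α : H →ₗ[k] H) : Prop where
  mul_mult : ∀ a b : H, α (μ (a ⊗ₜ[k] b)) = μ (α a ⊗ₜ[k] α b)
  hom_assoc : ∀ a b c : H, μ (α a ⊗ₜ[k] μ (b ⊗ₜ[k] c)) = μ (μ (a ⊗ₜ[k] b) ⊗ₜ[k] α c)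
  comul_compat : TensorProduct.map α α ∘ₗ Δ = Δ ∘ₗ α
  hom_coassoc : (TensorProduct.assoc k H H H).toLinearMap ∘ₗ TensorProduct.map Δ α ∘ₗ Δ
      = TensorProduct.map α Δ ∘ₗ Δ
  comul_mul : Δ ∘ₗ μ
      = TensorProduct.map μ μ ∘ₗ ttc k H H H H ∘ₗ TensorProduct.map Δ Δ

/-- Left module over a Hom-(bi)algebra. -/
structure IsHomModule (μ : H ⊗[k] H →ₗ[k] H) (α : H →ₗ[k] H)
    (ρ : H ⊗[k] M →ₗ[k] M) (αM : M →ₗ[k] M) : Prop where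
  str_compat : ∀ (h : H) (m : M), αM (ρ (h ⊗ₜ[k] m)) = ρ (α h ⊗ₜ[k] αM m)
  hom_smul : ∀ (h h' : H) (m : M),
      ρ (α h ⊗ₜ[k] ρ (h' ⊗ₜ[k] m)) = ρ (μ (h ⊗ₜ[k] h') ⊗ₜ[k] αM m)

/-- Left comodule over a Hom-(bi)algebra. -/
structure IsHomComodule (Δ : H →ₗ[k] H ⊗[k] H) (α : H →ₗ[k] H)
    (lM : M →ₗ[k] H ⊗[k] M) (αM : M →ₗ[k] M) : Prop where
  str_compat : TensorProduct.map α αM ∘ₗ lM = lM ∘ₗ αM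
  hom_coact : TensorProduct.map Δ αM ∘ₗ lM
      = (TensorProduct.assoc k H H M).symm.toLinearMap ∘ₗ TensorProduct.map α lM ∘ₗ lM

/-- `h ⊗ m ↦ (h₁·m)₍₋₁₎ β(h₂) ⊗ (h₁·m)₍₀₎`. -/
def ydL (μ : H ⊗[k] H →ₗ[k] H) (Δ : H →ₗ[k] H ⊗[k] H) (β : H →ₗ[k] H)
    (ρ : H ⊗[k] M →ₗ[k] M) (lM : M →ₗ[k] H ⊗[k] M) : H ⊗[k] M →ₗ[k] H ⊗[k] M :=
  TensorProduct.map μ LinearMap.id ∘ₗ rearr k H M H ∘ₗ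
    TensorProduct.map (lM ∘ₗ ρ) β ∘ₗ rearr k H H M ∘ₗ
      TensorProduct.map Δ LinearMap.id

/-- `h ⊗ m ↦ β(h₁) γ(m₍₋₁₎) ⊗ γ(h₂)·m₍₀₎`. -/
def ydR (μ : H ⊗[k] H →ₗ[k] H) (Δ : H →ₗ[k] H ⊗[k] H) (β γ : H →ₗ[k] H)
    (ρ : H ⊗[k] M →ₗ[k] M) (lM : M →ₗ[k] H ⊗[k] M) : H ⊗[k] M →ₗ[k] H ⊗[k] M :=
  TensorProduct.map (μ ∘ₗ TensorProduct.map β γ) (ρ ∘ₗ TensorProduct.map γ LinearMap.id) ∘ₗ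
    ttc k H H H M ∘ₗ TensorProduct.map Δ lM

/-- Yetter-Drinfeld module over a Hom-bialgebra: Hom-module, Hom-comodule and the
compatibility `(h₁·m)₍₋₁₎ α²(h₂) ⊗ (h₁·m)₍₀₎ = α²(h₁) α(m₍₋₁₎) ⊗ α(h₂)·m₍₀₎`. -/
def IsYetterDrinfeld (μ : H ⊗[k] H →ₗ[k] H) (Δ : H →ₗ[k] H ⊗[k] H) (α : H →ₗ[k] H)
    (ρ : H ⊗[k] M →ₗ[k] M) (lM : M →ₗ[k] H ⊗[k] M) (αM : M →ₗ[k] M) : Prop :=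
  IsHomModule k μ α ρ αM ∧ IsHomComodule k Δ α lM αM ∧
    ydL k μ Δ (α ∘ₗ α) ρ lM = ydR k μ Δ (α ∘ₗ α) α ρ lM

/-- `m ⊗ n ↦ αHinv(m₍₋₁₎)·n ⊗ m₍₀₎`. -/
def Bmap (αHinv : H →ₗ[k] H) (lM : M →ₗ[k] H ⊗[k] M) (ρN : H ⊗[k] N →ₗ[k] N) :
    M ⊗[k] N →ₗ[k] N ⊗[k] M :=
  TensorProduct.map (ρN ∘ₗ TensorProduct.map αHinv LinearMap.id) LinearMap.id ∘ₗ
    rearr k H M N ∘ₗ TensorProduct.map lM LinearMap.id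

/-- Quasi-braiding `m ⊗ n ↦ αN⁻¹(αH⁻¹(m₍₋₁₎)·n) ⊗ αM⁻¹(m₍₀₎)`. -/
def braidYD (αH : H ≃ₗ[k] H) (αM : M ≃ₗ[k] M) (αN : N ≃ₗ[k] N)
    (lM : M →ₗ[k] H ⊗[k] M) (ρN : H ⊗[k] N →ₗ[k] N) : M ⊗[k] N →ₗ[k] N ⊗[k] M :=
  TensorProduct.map
      (αN.symm.toLinearMap ∘ₗ ρN ∘ₗ TensorProduct.map αH.symm.toLinearMap LinearMap.id)
      αM.symm.toLinearMap ∘ₗ rearr k H M N ∘ₗ TensorProduct.map lM LinearMap.id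

/-- Action on `M ⊗ N`: `h ⊗ (m ⊗ n) ↦ h₁·m ⊗ h₂·n`. -/
def hatAction (Δ : H →ₗ[k] H ⊗[k] H)
    (ρM : H ⊗[k] M →ₗ[k] M) (ρN : H ⊗[k] N →ₗ[k] N) :
    H ⊗[k] (M ⊗[k] N) →ₗ[k] M ⊗[k] N :=
  TensorProduct.map ρM ρN ∘ₗ ttc k H H M N ∘ₗ TensorProduct.map Δ LinearMap.id

/-- Coaction on `M ⊗ N`: `m ⊗ n ↦ αHinv²(m₍₋₁₎ n₍₋₁₎) ⊗ (m₍₀₎ ⊗ n₍₀₎)`. -/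
def hatCoaction (μ : H ⊗[k] H →ₗ[k] H) (αHinv : H →ₗ[k] H)
    (lM : M →ₗ[k] H ⊗[k] M) (lN : N →ₗ[k] H ⊗[k] N) :
    M ⊗[k] N →ₗ[k] H ⊗[k] (M ⊗[k] N) :=
  TensorProduct.map (αHinv ∘ₗ αHinv ∘ₗ μ) LinearMap.id ∘ₗ ttc k H M H N ∘ₗ
    TensorProduct.map lM lN

/-- Action on `M ⊗ N`: `h ⊗ (m ⊗ n) ↦ αHinv²(h₁)·m ⊗ αHinv²(h₂)·n`. -/
def tildeAction (Δ : H →ₗ[k] H ⊗[k] H) (αHinv : H →ₗ[k] H)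
    (ρM : H ⊗[k] M →ₗ[k] M) (ρN : H ⊗[k] N →ₗ[k] N) :
    H ⊗[k] (M ⊗[k] N) →ₗ[k] M ⊗[k] N :=
  TensorProduct.map ρM ρN ∘ₗ ttc k H H M N ∘ₗ
    TensorProduct.map
      (TensorProduct.map (αHinv ∘ₗ αHinv) (αHinv ∘ₗ αHinv) ∘ₗ Δ) LinearMap.id

/-- Coaction on `M ⊗ N`: `m ⊗ n ↦ m₍₋₁₎ n₍₋₁₎ ⊗ (m₍₀₎ ⊗ n₍₀₎)`. -/
def tildeCoaction (μ : H ⊗[k] H →ₗ[k] H)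
    (lM : M →ₗ[k] H ⊗[k] M) (lN : N →ₗ[k] H ⊗[k] N) :
    M ⊗[k] N →ₗ[k] H ⊗[k] (M ⊗[k] N) :=
  TensorProduct.map μ LinearMap.id ∘ₗ ttc k H M H N ∘ₗ TensorProduct.map lM lN

/-- Associator `(x ⊗ y) ⊗ z ↦ αX⁻¹(x) ⊗ (y ⊗ αZ(z))`. -/
def aYD {X Z : Type*} [AddCommGroup X] [Module k X] [AddCommGroup Z] [Module k Z]
    (αX : X ≃ₗ[k] X) (Y : Type*) [AddCommGroup Y] [Module k Y] (αZ : Z ≃ₗ[k] Z) :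
    (X ⊗[k] Y) ⊗[k] Z →ₗ[k] X ⊗[k] (Y ⊗[k] Z) :=
  (TensorProduct.assoc k X Y Z).toLinearMap ∘ₗ
    TensorProduct.map (TensorProduct.map αX.symm.toLinearMap LinearMap.id) αZ.toLinearMap

/-- Inverse associator `x ⊗ (y ⊗ z) ↦ (αX(x) ⊗ y) ⊗ αZ⁻¹(z)`. -/
def aYDinv {X Z : Type*} [AddCommGroup X] [Module k X] [AddCommGroup Z] [Module k Z]
    (αX : X ≃ₗ[k] X) (Y : Type*) [AddCommGroup Y] [Module k Y] (αZ : Z ≃ₗ[k] Z) :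
    X ⊗[k] (Y ⊗[k] Z) →ₗ[k] (X ⊗[k] Y) ⊗[k] Z :=
  TensorProduct.map (TensorProduct.map αX.toLinearMap LinearMap.id) αZ.symm.toLinearMap ∘ₗ
    (TensorProduct.assoc k X Y Z).symm.toLinearMap

/-- Associator `(x ⊗ y) ⊗ z ↦ αX(x) ⊗ (y ⊗ αZ⁻¹(z))`. -/
def aTilde {X Z : Type*} [AddCommGroup X] [Module k X] [AddCommGroup Z] [Module k Z]
    (αX : X ≃ₗ[k] X) (Y : Type*) [AddCommGroup Y] [Module k Y] (αZ : Z ≃ₗ[k] Z) :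
    (X ⊗[k] Y) ⊗[k] Z →ₗ[k] X ⊗[k] (Y ⊗[k] Z) :=
  (TensorProduct.assoc k X Y Z).toLinearMap ∘ₗ
    TensorProduct.map (TensorProduct.map αX.toLinearMap LinearMap.id) αZ.symm.toLinearMap

/-- Inverse associator `x ⊗ (y ⊗ z) ↦ (αX⁻¹(x) ⊗ y) ⊗ αZ(z)`. -/
def aTildeInv {X Z : Type*} [AddCommGroup X] [Module k X] [AddCommGroup Z] [Module k Z]
    (αX : X ≃ₗ[k] X) (Y : Type*) [AddCommGroup Y] [Module k Y] (αZ : Z ≃ₗ[k] Z) :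
    X ⊗[k] (Y ⊗[k] Z) →ₗ[k] (X ⊗[k] Y) ⊗[k] Z :=
  TensorProduct.map (TensorProduct.map αX.symm.toLinearMap LinearMap.id) αZ.toLinearMap ∘ₗ
    (TensorProduct.assoc k X Y Z).symm.toLinearMap

/-- Quasitriangular Hom-bialgebra. -/
def IsQuasitriangular (μ : H ⊗[k] H →ₗ[k] H) (Δ : H →ₗ[k] H ⊗[k] H) (α : H →ₗ[k] H)
    (R : H ⊗[k] H) : Prop :=
  IsHomBialgebra k μ Δ α ∧
  TensorProduct.map Δ α R
    = TensorProduct.map (TensorProduct.map α α) μ (ttc k H H H H (R ⊗ₜ[k] R)) ∧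
  TensorProduct.map α Δ R
    = TensorProduct.map μ (TensorProduct.map α α ∘ₗ (TensorProduct.comm k H H).toLinearMap)
        (ttc k H H H H (R ⊗ₜ[k] R)) ∧
  ∀ h : H, TensorProduct.map μ μ (ttc k H H H H ((TensorProduct.comm k H H (Δ h)) ⊗ₜ[k] R))
      = TensorProduct.map μ μ (ttc k H H H H (R ⊗ₜ[k] Δ h))

/-- Coaction induced by an R-matrix: `m ↦ α(R²) ⊗ R¹·m`. -/
def coactionFromR (R : H ⊗[k] H) (α : H →ₗ[k] H) (ρM : H ⊗[k] M →ₗ[k] M) :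
    M →ₗ[k] H ⊗[k] M :=
  (TensorProduct.comm k M H).toLinearMap ∘ₗ TensorProduct.map ρM α ∘ₗ rearr k H H M ∘ₗ
    TensorProduct.mk k (H ⊗[k] H) M R

/-- Quasi-braiding from an R-matrix: `m ⊗ n ↦ αN⁻¹(R²·n) ⊗ αM⁻¹(R¹·m)`. -/
def braidR (R : H ⊗[k] H) (ρM : H ⊗[k] M →ₗ[k] M) (ρN : H ⊗[k] N →ₗ[k] N)
    (αM : M ≃ₗ[k] M) (αN : N ≃ₗ[k] N) : M ⊗[k] N →ₗ[k] N ⊗[k] M :=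
  TensorProduct.map αN.symm.toLinearMap αM.symm.toLinearMap ∘ₗ
    (TensorProduct.comm k M N).toLinearMap ∘ₗ TensorProduct.map ρM ρN ∘ₗ
      ttc k H H M N ∘ₗ TensorProduct.mk k (H ⊗[k] H) (M ⊗[k] N) R

/-- Coquasitriangular Hom-bialgebra. -/
def IsCoquasitriangular (μ : H ⊗[k] H →ₗ[k] H) (Δ : H →ₗ[k] H ⊗[k] H) (α : H →ₗ[k] H)
    (σ : H ⊗[k] H →ₗ[k] k) : Prop :=
  IsHomBialgebra k μ Δ α ∧
  (∀ x y z : H, σ (μ (x ⊗ₜ[k] y) ⊗ₜ[k] α z)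
      = LinearMap.mul' k k
          (TensorProduct.map σ σ (ttc k H H H H ((α x ⊗ₜ[k] α y) ⊗ₜ[k] Δ z)))) ∧
  (∀ x y z : H, σ (α x ⊗ₜ[k] μ (y ⊗ₜ[k] z))
      = LinearMap.mul' k k
          (TensorProduct.map σ σ (ttc k H H H H (Δ x ⊗ₜ[k] (α z ⊗ₜ[k] α y))))) ∧
  (∀ x y : H,
      (TensorProduct.rid k H)
        (TensorProduct.map (μ ∘ₗ (TensorProduct.comm k H H).toLinearMap) σ
          (ttc k H H H H (Δ x ⊗ₜ[k] Δ y)))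
      = (TensorProduct.lid k H)
          (TensorProduct.map σ μ (ttc k H H H H (Δ x ⊗ₜ[k] Δ y))))

/-- Action induced by a coquasitriangular form: `h ⊗ m ↦ σ(m₍₋₁₎ ⊗ α(h)) • m₍₀₎`. -/
def actionFromSigma (σ : H ⊗[k] H →ₗ[k] k) (α : H →ₗ[k] H)
    (lM : M →ₗ[k] H ⊗[k] M) : H ⊗[k] M →ₗ[k] M :=
  (TensorProduct.lid k M).toLinearMap ∘ₗ
    TensorProduct.map (σ ∘ₗ TensorProduct.map LinearMap.id α ∘ₗ
        (TensorProduct.comm k H H).toLinearMap) LinearMap.id ∘ₗ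
      (TensorProduct.assoc k H H M).symm.toLinearMap ∘ₗ
        TensorProduct.map LinearMap.id lM

/-- Quasi-braiding from a coquasitriangular form:
`m ⊗ n ↦ σ(n₍₋₁₎ ⊗ m₍₋₁₎) • (αN⁻¹(n₍₀₎) ⊗ αM⁻¹(m₍₀₎))`. -/
def braidSigma (σ : H ⊗[k] H →ₗ[k] k)
    (lM : M →ₗ[k] H ⊗[k] M) (lN : N →ₗ[k] H ⊗[k] N)
    (αM : M ≃ₗ[k] M) (αN : N ≃ₗ[k] N) : M ⊗[k] N →ₗ[k] N ⊗[k] M :=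
  (TensorProduct.lid k (N ⊗[k] M)).toLinearMap ∘ₗ
    TensorProduct.map (σ ∘ₗ (TensorProduct.comm k H H).toLinearMap)
      (TensorProduct.map αN.symm.toLinearMap αM.symm.toLinearMap ∘ₗ
        (TensorProduct.comm k M N).toLinearMap) ∘ₗ
      ttc k H M H N ∘ₗ TensorProduct.map lM lN


section Lemmas

variable {k : Type*} [Field k] {A B C D : Type*}
variable [AddCommGroup A] [Module k A] [AddCommGroup B] [Module k B]
variable [AddCommGroup C] [Module k C] [AddCommGroup D] [Module k D]

@[simp]
theorem rearr_tmul (a : A) (b : B) (c : C) :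
    rearr k A B C ((a ⊗ₜ[k] b) ⊗ₜ[k] c) = (a ⊗ₜ[k] c) ⊗ₜ[k] b := rfl

@[simp]
theorem ttc_tmul (a : A) (b : B) (c : C) (d : D) :
    ttc k A B C D ((a ⊗ₜ[k] b) ⊗ₜ[k] (c ⊗ₜ[k] d)) = (a ⊗ₜ[k] c) ⊗ₜ[k] (b ⊗ₜ[k] d) := rfl

@[simp]
theorem aTilde_tmul (αA : A ≃ₗ[k] A) (αC : C ≃ₗ[k] C) (a : A) (b : B) (c : C) :
    aTilde k αA B αC ((a ⊗ₜ[k] b) ⊗ₜ[k] c) = αA a ⊗ₜ[k] (b ⊗ₜ[k] αC.symm c) := rfl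

@[simp]
theorem aTildeInv_tmul (αA : A ≃ₗ[k] A) (αC : C ≃ₗ[k] C) (a : A) (b : B) (c : C) :
    aTildeInv k αA B αC (a ⊗ₜ[k] (b ⊗ₜ[k] c)) = (αA.symm a ⊗ₜ[k] b) ⊗ₜ[k] αC c := rfl

/-- The map `h ⊗ a ↦ αB⁻¹(αA⁻¹(h)·b) ⊗ αC⁻¹(a)`, through which the quasi-braiding at `b`
factors after the coaction. -/
def braidAux (αA : A ≃ₗ[k] A) (αB : B ≃ₗ[k] B) (αC : C ≃ₗ[k] C) (ρ : A ⊗[k] B →ₗ[k] B)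
    (b : B) : A ⊗[k] C →ₗ[k] B ⊗[k] C :=
  TensorProduct.map (αB.symm.toLinearMap ∘ₗ ρ ∘ₗ (TensorProduct.mk k A B).flip b ∘ₗ
    αA.symm.toLinearMap) αC.symm.toLinearMap

@[simp]
theorem braidAux_tmul (αA : A ≃ₗ[k] A) (αB : B ≃ₗ[k] B) (αC : C ≃ₗ[k] C)
    (ρ : A ⊗[k] B →ₗ[k] B) (b : B) (a : A) (c : C) :
    braidAux αA αB αC ρ b (a ⊗ₜ[k] c) = αB.symm (ρ (αA.symm a ⊗ₜ[k] b)) ⊗ₜ[k] αC.symm c := rfl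

theorem braidYD_tmul (αA : A ≃ₗ[k] A) (αB : B ≃ₗ[k] B) (αC : C ≃ₗ[k] C)
    (l : C →ₗ[k] A ⊗[k] C) (ρ : A ⊗[k] B →ₗ[k] B) (c : C) (b : B) :
    braidYD k αA αC αB l ρ (c ⊗ₜ[k] b) = braidAux αA αB αC ρ b (l c) := by
  simp only [braidYD, LinearMap.comp_apply, TensorProduct.map_tmul, LinearMap.id_apply]
  induction l c with
  | zero => simp
  | add x y hx hy => simp only [TensorProduct.add_tmul, map_add, hx, hy]
  | tmul a c => simp

theorem coaction_symm {αA : A ≃ₗ[k] A} {αC : C ≃ₗ[k] C} {l : C →ₗ[k] A ⊗[k] C}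
    (h : TensorProduct.map αA.toLinearMap αC.toLinearMap ∘ₗ l = l ∘ₗ αC.toLinearMap) (c : C) :
    l (αC.symm c) = TensorProduct.map αA.symm.toLinearMap αC.symm.toLinearMap (l c) := by
  apply (TensorProduct.congr αA αC).injective
  have h' := LinearMap.congr_fun h (αC.symm c)
  simp only [LinearMap.comp_apply, LinearEquiv.coe_coe, LinearEquiv.apply_symm_apply] at h'
  refine h'.trans ?_
  exact ((TensorProduct.congr αA αC).apply_symm_apply (l c)).symm

theorem action_symm {αA : A ≃ₗ[k] A} {αB : B ≃ₗ[k] B} {ρ : A ⊗[k] B →ₗ[k] B}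
    (h : ∀ a b, αB (ρ (a ⊗ₜ[k] b)) = ρ (αA a ⊗ₜ[k] αB b)) (a : A) (b : B) :
    αB.symm (ρ (a ⊗ₜ[k] b)) = ρ (αA.symm a ⊗ₜ[k] αB.symm b) := by
  rw [LinearEquiv.symm_apply_eq, h]
  simp

end Lemmas

section Hexagon

variable {k : Type*} [Field k] {H M N P : Type*}
variable [AddCommGroup H] [Module k H] [AddCommGroup M] [Module k M]
variable [AddCommGroup N] [Module k N] [AddCommGroup P] [Module k P]

theorem hexagon_left {Δ : H →ₗ[k] H ⊗[k] H} {αH : H ≃ₗ[k] H}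
    {lM : M →ₗ[k] H ⊗[k] M} {αM : M ≃ₗ[k] M}
    (hM : IsHomComodule k Δ αH.toLinearMap lM αM.toLinearMap)
    {ρN : H ⊗[k] N →ₗ[k] N} {αN : N ≃ₗ[k] N}
    {ρP : H ⊗[k] P →ₗ[k] P} {αP : P ≃ₗ[k] P} :
    aTilde k αN P αM ∘ₗ
        braidYD k αH αM (TensorProduct.congr αN αP) lM
          (tildeAction k Δ αH.symm.toLinearMap ρN ρP) ∘ₗ
          aTilde k αM N αP
      = TensorProduct.map (LinearMap.id : N →ₗ[k] N) (braidYD k αH αM αP lM ρP) ∘ₗ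
          aTilde k αN M αP ∘ₗ
            TensorProduct.map (braidYD k αH αM αN lM ρN) (LinearMap.id : P →ₗ[k] P) := by
  refine TensorProduct.ext_threefold fun m n p => ?_
  simp only [LinearMap.comp_apply, aTilde_tmul, TensorProduct.map_tmul, braidYD_tmul,
    LinearMap.id_apply]
  have hl : lM (αM m) = TensorProduct.map αH.toLinearMap αM.toLinearMap (lM m) :=
    (LinearMap.congr_fun hM.str_compat m).symm
  rw [hl]
  -- Both sides are the image under `G` of the corresponding side of `hom_coact` at `m`.
  let f : H →ₗ[k] N := ρN ∘ₗ (TensorProduct.mk k H N).flip n ∘ₗ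
    αH.symm.toLinearMap ∘ₗ αH.symm.toLinearMap
  let g : H →ₗ[k] P := αP.symm.toLinearMap ∘ₗ ρP ∘ₗ
    (TensorProduct.mk k H P).flip (αP.symm p) ∘ₗ αH.symm.toLinearMap ∘ₗ αH.symm.toLinearMap
  let G : (H ⊗[k] H) ⊗[k] M →ₗ[k] N ⊗[k] (P ⊗[k] M) :=
    (TensorProduct.assoc k N P M).toLinearMap ∘ₗ
      TensorProduct.map (TensorProduct.map f g) (αM.symm.toLinearMap ∘ₗ αM.symm.toLinearMap)
  have hL : ∀ t : H ⊗[k] M,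
      aTilde k αN P αM (braidAux αH (TensorProduct.congr αN αP) αM
        (tildeAction k Δ αH.symm.toLinearMap ρN ρP) (n ⊗ₜ[k] αP.symm p)
        (TensorProduct.map αH.toLinearMap αM.toLinearMap t))
      = G (TensorProduct.map Δ αM.toLinearMap t) := by
    intro t
    induction t with
    | zero => simp
    | add x y hx hy => simp only [map_add, hx, hy]
    | tmul h x =>
      simp only [TensorProduct.map_tmul, braidAux_tmul, tildeAction, LinearMap.comp_apply,
        LinearEquiv.coe_coe, LinearEquiv.symm_apply_apply, LinearMap.id_apply, G]
      induction Δ h with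
      | zero => simp
      | add x y hx hy => simp only [map_add, TensorProduct.add_tmul, hx, hy]
      | tmul a b => simp [f, g]
  have hR : ∀ t : H ⊗[k] M,
      TensorProduct.map (LinearMap.id : N →ₗ[k] N) (braidYD k αH αM αP lM ρP)
        (aTilde k αN M αP (braidAux αH αN αM ρN n t ⊗ₜ[k] p))
      = G ((TensorProduct.assoc k H H M).symm
          (TensorProduct.map αH.toLinearMap lM t)) := by
    intro t
    induction t with
    | zero => simp
    | add x y hx hy => simp only [map_add, TensorProduct.add_tmul, hx, hy]
    | tmul h x =>
      simp only [TensorProduct.map_tmul, braidAux_tmul, aTilde_tmul, braidYD_tmul,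
        LinearMap.id_apply, coaction_symm hM.str_compat, G, LinearMap.comp_apply]
      induction lM x with
      | zero => simp
      | add x y hx hy => simp only [map_add, TensorProduct.tmul_add, hx, hy]
      | tmul a b => simp [f, g]
  rw [hL, hR]
  exact congrArg G (LinearMap.congr_fun hM.hom_coact m)

theorem hexagon_right {μ : H ⊗[k] H →ₗ[k] H} {αH : H ≃ₗ[k] H}
    (hμ : ∀ a b : H, αH (μ (a ⊗ₜ[k] b)) = μ (αH a ⊗ₜ[k] αH b))
    {lM : M →ₗ[k] H ⊗[k] M} {αM : M ≃ₗ[k] M}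
    (hM : TensorProduct.map αH.toLinearMap αM.toLinearMap ∘ₗ lM = lM ∘ₗ αM.toLinearMap)
    {lN : N →ₗ[k] H ⊗[k] N} {αN : N ≃ₗ[k] N}
    {ρP : H ⊗[k] P →ₗ[k] P} {αP : P ≃ₗ[k] P}
    (hP : IsHomModule k μ αH.toLinearMap ρP αP.toLinearMap) :
    aTildeInv k αP M αN ∘ₗ
        braidYD k αH (TensorProduct.congr αM αN) αP (tildeCoaction k μ lM lN) ρP ∘ₗ
          aTildeInv k αM N αP
      = TensorProduct.map (braidYD k αH αM αP lM ρP) (LinearMap.id : N →ₗ[k] N) ∘ₗ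
          aTildeInv k αM P αN ∘ₗ
            TensorProduct.map (LinearMap.id : M →ₗ[k] M) (braidYD k αH αN αP lN ρP) := by
  apply TensorProduct.ext
  refine LinearMap.ext fun m => TensorProduct.ext' fun n p => ?_
  simp only [LinearMap.compr₂ₛₗ_apply, TensorProduct.mk_apply,
    LinearMap.comp_apply, aTildeInv_tmul, TensorProduct.map_tmul, braidYD_tmul,
    LinearMap.id_apply, tildeCoaction, coaction_symm hM]
  induction lN n with
  | zero => simp
  | add x y hx hy => simp only [map_add, TensorProduct.tmul_add, hx, hy]
  | tmul b n =>
    simp only [braidAux_tmul, aTildeInv_tmul, TensorProduct.map_tmul, braidYD_tmul,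
      LinearMap.id_apply, coaction_symm hM, LinearEquiv.apply_symm_apply]
    induction lM m with
    | zero => simp
    | add x y hx hy => simp only [map_add, TensorProduct.add_tmul, hx, hy]
    | tmul a m =>
      have key : ρP (αH.symm (μ (αH.symm a ⊗ₜ[k] b)) ⊗ₜ[k] αP p)
          = ρP (αH.symm a ⊗ₜ[k] ρP (αH.symm b ⊗ₜ[k] p)) := by
        have h := hP.hom_smul (αH.symm (αH.symm a)) (αH.symm b) p
        simp only [LinearEquiv.coe_coe, LinearEquiv.apply_symm_apply] at h
        rw [h, action_symm hμ]
      simp [key, action_symm hP.str_compat]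

end Hexagon


/-- pentagon axiom for the associators `𝔞` and the two hexagon relations for
the quasi-braiding `c` on the category of Yetter-Drinfeld modules with the ⊗̃ structures. -/
theorem stmt16 {k H M N P Q : Type*} [Field k]
    [AddCommGroup H] [Module k H] [AddCommGroup M] [Module k M]
    [AddCommGroup N] [Module k N] [AddCommGroup P] [Module k P] [AddCommGroup Q] [Module k Q]
    (μ : H ⊗[k] H →ₗ[k] H) (Δ : H →ₗ[k] H ⊗[k] H) (αH : H ≃ₗ[k] H)
    (hH : IsHomBialgebra k μ Δ αH.toLinearMap)
    (ρM : H ⊗[k] M →ₗ[k] M) (lM : M →ₗ[k] H ⊗[k] M) (αM : M ≃ₗ[k] M)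
    (hM : IsYetterDrinfeld k μ Δ αH.toLinearMap ρM lM αM.toLinearMap)
    (ρN : H ⊗[k] N →ₗ[k] N) (lN : N →ₗ[k] H ⊗[k] N) (αN : N ≃ₗ[k] N)
    (hN : IsYetterDrinfeld k μ Δ αH.toLinearMap ρN lN αN.toLinearMap)
    (ρP : H ⊗[k] P →ₗ[k] P) (lP : P →ₗ[k] H ⊗[k] P) (αP : P ≃ₗ[k] P)
    (hP : IsYetterDrinfeld k μ Δ αH.toLinearMap ρP lP αP.toLinearMap)
    (ρQ : H ⊗[k] Q →ₗ[k] Q) (lQ : Q →ₗ[k] H ⊗[k] Q) (αQ : Q ≃ₗ[k] Q)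
    (hQ : IsYetterDrinfeld k μ Δ αH.toLinearMap ρQ lQ αQ.toLinearMap) :
    (TensorProduct.map (LinearMap.id : M →ₗ[k] M) (aTilde k αN P αQ) ∘ₗ
        aTilde k αM (N ⊗[k] P) αQ ∘ₗ
          TensorProduct.map (aTilde k αM N αP) (LinearMap.id : Q →ₗ[k] Q)
      = aTilde k αM N (TensorProduct.congr αP αQ) ∘ₗ
          aTilde k (TensorProduct.congr αM αN) P αQ) ∧
    (aTilde k αN P αM ∘ₗ
        braidYD k αH αM (TensorProduct.congr αN αP) lM
          (tildeAction k Δ αH.symm.toLinearMap ρN ρP) ∘ₗ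
          aTilde k αM N αP
      = TensorProduct.map (LinearMap.id : N →ₗ[k] N) (braidYD k αH αM αP lM ρP) ∘ₗ
          aTilde k αN M αP ∘ₗ
            TensorProduct.map (braidYD k αH αM αN lM ρN) (LinearMap.id : P →ₗ[k] P)) ∧
    (aTildeInv k αP M αN ∘ₗ
        braidYD k αH (TensorProduct.congr αM αN) αP (tildeCoaction k μ lM lN) ρP ∘ₗ
          aTildeInv k αM N αP
      = TensorProduct.map (braidYD k αH αM αP lM ρP) (LinearMap.id : N →ₗ[k] N) ∘ₗ
          aTildeInv k αM P αN ∘ₗ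
            TensorProduct.map (LinearMap.id : M →ₗ[k] M) (braidYD k αH αN αP lN ρP)) := by
  refine ⟨?_, hexagon_left hM.2.1, hexagon_right hH.mul_mult hM.2.1.str_compat hP.1⟩
  refine TensorProduct.ext_fourfold fun m n p q => ?_
  simp

end HomYD
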